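/- arXiv:2205.01828 — 2 statements merged into one kernel-verified Lean document; each statement's English description precedes it below -/
import Mathlib

section
/- Suppose q is even with q ≥ 4, r = 2m+1 is coprime to q, and m > (q+5)/2. Let c₋ (respectively c₊) be the column index of the unique nonzero entry of row q/2 − 1 (respectively row q/2 + 1) of the matrix R. Then: c₋ = 0 if and only if q = 4; c₋ = l* if and only if q = 6; and if q ≥ 8, then neither c₋ nor c₊ equals 0 or l*. -/
open scoped Classical

/-- The reduced index `ρ(n) = min(n % r, r − n % r)`. -/
noncomputable def rho (r n : ℕ) : ℕ := min (n % r) (r - n % r)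

/-- The sign `σ(n) = (−1)^⌊n/r⌋`. -/
noncomputable def sgn (r n : ℕ) : ℤ := (-1) ^ (n / r)

/-- The entry of the matrix `R` in row (labelled) `i ∈ {1,…,m}` and column `l ∈ {0,…,m−1}`:
column `0` is `e_1`, and for `1 ≤ l ≤ m−1` the column is the reduction of
`f_l = e_{ql+1} − A^{2pl} e_{ql−1}`. -/
noncomputable def Rent (m q : ℕ) (p : ℤ) (A : ℂ) (i l : ℕ) : ℂ :=
  if l = 0 then (if i = 1 then 1 else 0)
  else
    (if rho (2*m+1) (q*l+1) = i then ((sgn (2*m+1) (q*l+1) : ℤ) : ℂ) else 0)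
      - A ^ (2 * p * (l : ℤ)) *
        (if rho (2*m+1) (q*l-1) = i then ((sgn (2*m+1) (q*l-1) : ℤ) : ℂ) else 0)

/-- The matrix `R`, with rows indexed by `i = 1,…,m` and columns by `l = 0,…,m−1`. -/
noncomputable def Rmat (m q : ℕ) (p : ℤ) (A : ℂ) : Matrix (Fin m) (Fin m) ℂ :=
  fun i l => Rent m q p A ((i : ℕ) + 1) (l : ℕ)

/-- The reduced index of `n` is congruent to `n` up to sign. -/
theorem dvd_sub_or_dvd_add_of_rho_eq {r n i : ℕ} (hr : 0 < r) (h : rho r n = i) :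
    (r : ℤ) ∣ (n : ℤ) - i ∨ (r : ℤ) ∣ (n : ℤ) + i := by
  have hlt := Nat.mod_lt n hr
  have hdiv : (r : ℤ) * ((n / r : ℕ) : ℤ) + ((n % r : ℕ) : ℤ) = n := by
    exact_mod_cast Nat.div_add_mod n r
  unfold rho at h
  rcases le_total (n % r) (r - n % r) with h' | h'
  · rw [min_eq_left h'] at h
    exact Or.inl ⟨((n / r : ℕ) : ℤ), by rw [← h]; linarith⟩
  · rw [min_eq_right h'] at h
    refine Or.inr ⟨((n / r : ℕ) : ℤ) + 1, ?_⟩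
    rw [← h, Nat.cast_sub hlt.le]
    linarith

theorem rho_eq_or_rho_eq_of_Rent_ne_zero {m q : ℕ} {p : ℤ} {A : ℂ} {i l : ℕ} (hl : l ≠ 0)
    (h : Rent m q p A i l ≠ 0) :
    rho (2*m+1) (q*l+1) = i ∨ rho (2*m+1) (q*l-1) = i := by
  by_contra! hne
  exact h (by simp [Rent, hl, hne.1, hne.2])

theorem Rent_zero_ne_zero_iff {m q : ℕ} {p : ℤ} {A : ℂ} {i : ℕ} :
    Rent m q p A i 0 ≠ 0 ↔ i = 1 := by
  simp [Rent]

/-- A nonzero entry of row `k ± 1` of `R`, for `q = 2k`, outside column `0` lies in a column `l`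
with `ql ≡ ±(k ± 2)` modulo `r`. -/
theorem dvd_of_Rent_ne_zero {m k : ℕ} {p : ℤ} {A : ℂ} {i l : ℕ} {s : ℤ}
    (hk : 0 < k) (hco : IsCoprime ((2*m+1 : ℕ) : ℤ) (k : ℤ)) (hs : s = 1 ∨ s = -1)
    (hi : (i : ℤ) = k + s) (hl : l ≠ 0) (hlm : l < m) (h : Rent m (2*k) p A i l ≠ 0) :
    ((2*m+1 : ℕ) : ℤ) ∣ 2*k*l - (k + 2*s) ∨ ((2*m+1 : ℕ) : ℤ) ∣ 2*k*l + (k + 2*s) := by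
  have hsub : ¬ ((2*m+1 : ℕ) : ℤ) ∣ 2*k*l - k := fun hd => by
    have hd' : ((2*m+1 : ℕ) : ℤ) ∣ 2*l - 1 := hco.dvd_of_dvd_mul_left
      (by rwa [show (k : ℤ) * (2*l - 1) = 2*k*l - k by ring])
    have := Int.le_of_dvd (by omega) hd'
    omega
  have hadd : ¬ ((2*m+1 : ℕ) : ℤ) ∣ 2*k*l + k := fun hd => by
    have hd' : ((2*m+1 : ℕ) : ℤ) ∣ 2*l + 1 := hco.dvd_of_dvd_mul_left
      (by rwa [show (k : ℤ) * (2*l + 1) = 2*k*l + k by ring])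
    have := Int.le_of_dvd (by omega) hd'
    omega
  have hpos : 1 ≤ 2*k*l := by have := Nat.mul_pos hk (Nat.pos_of_ne_zero hl); nlinarith
  rcases rho_eq_or_rho_eq_of_Rent_ne_zero hl h with h | h <;>
    rcases dvd_sub_or_dvd_add_of_rho_eq (by omega) h with hd | hd <;>
    [skip; skip; rw [Nat.cast_sub hpos] at hd; rw [Nat.cast_sub hpos] at hd] <;>
    rw [hi] at hd <;> push_cast at hd hsub hadd ⊢ <;> rcases hs with rfl | rfl <;>
    ring_nf at hd hsub hadd ⊢ <;> tauto

/-- If `n ≡ ±d` and `n ≡ ±1` modulo `r`, then `r` divides `d - 1` or `d + 1`. -/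
theorem dvd_sub_one_or_dvd_add_one {r n d : ℤ} (h₁ : r ∣ n - d ∨ r ∣ n + d)
    (h₂ : r ∣ n + 1 ∨ r ∣ n - 1) : r ∣ d - 1 ∨ r ∣ d + 1 := by
  rcases h₁ with ⟨a, ha⟩ | ⟨a, ha⟩ <;> rcases h₂ with ⟨b, hb⟩ | ⟨b, hb⟩
  · exact Or.inr ⟨b - a, by linarith⟩
  · exact Or.inl ⟨b - a, by linarith⟩
  · exact Or.inl ⟨a - b, by linarith⟩
  · exact Or.inr ⟨a - b, by linarith⟩

/-- For even `q ≥ 4`: the column `c₋` (resp. `c₊`) of the unique nonzero entry of row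
`q/2 − 1` (resp. `q/2 + 1`) satisfies: `c₋ = 0 ↔ q = 4`; `c₋ = l* ↔ q = 6`; and for
`q ≥ 8` neither `c₋` nor `c₊` equals `0` or `l*`. -/
theorem stmt_6 (m q : ℕ) (hm : 0 < m) (hq : 0 < q) (hqe : Even q) (hq4 : 4 ≤ q)
    (hco : Nat.Coprime (2*m+1) q) (hmq : q + 5 < 2*m) (p : ℤ) (A : ℂ)
    (hA : IsPrimitiveRoot A (2*(2*m+1)))
    (lstar : ℕ) (hl1 : 1 ≤ lstar) (hl2 : lstar ≤ m)
    (hldvd : (2*m+1) ∣ (q*lstar+1) ∨ (2*m+1) ∣ (q*lstar-1))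
    (cminus cplus : ℕ)
    (hcm : (Finset.range m).filter (fun l => Rent m q p A (q/2 - 1) l ≠ 0) = {cminus})
    (hcp : (Finset.range m).filter (fun l => Rent m q p A (q/2 + 1) l ≠ 0) = {cplus}) :
    (cminus = 0 ↔ q = 4) ∧ (cminus = lstar ↔ q = 6) ∧
    (8 ≤ q → cminus ≠ 0 ∧ cminus ≠ lstar ∧ cplus ≠ 0 ∧ cplus ≠ lstar) := by
  obtain ⟨k, rfl⟩ := hqe.two_dvd
  rw [Nat.mul_div_cancel_left k two_pos] at hcm hcp
  have hcoq : IsCoprime ((2*m+1 : ℕ) : ℤ) ((2*k : ℕ) : ℤ) := Nat.isCoprime_iff_coprime.2 hco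
  have hcok : IsCoprime ((2*m+1 : ℕ) : ℤ) (k : ℤ) :=
    Nat.isCoprime_iff_coprime.2 (Nat.Coprime.coprime_mul_left_right hco)
  have hpos : 1 ≤ 2*k*lstar := by nlinarith
  have hstar : ((2*m+1 : ℕ) : ℤ) ∣ 2*k*lstar + 1 ∨ ((2*m+1 : ℕ) : ℤ) ∣ 2*k*lstar - 1 := by
    refine hldvd.imp (fun h => ?_) (fun h => ?_)
    · exact_mod_cast h
    · have h := Int.natCast_dvd_natCast.2 h
      rw [Nat.cast_sub hpos] at h
      exact_mod_cast h
  have hmemm : cminus ∈ ({cminus} : Finset ℕ) := Finset.mem_singleton_self _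
  have hmemp : cplus ∈ ({cplus} : Finset ℕ) := Finset.mem_singleton_self _
  rw [← hcm, Finset.mem_filter, Finset.mem_range] at hmemm
  rw [← hcp, Finset.mem_filter, Finset.mem_range] at hmemp
  obtain ⟨hm1, hm2⟩ := hmemm
  obtain ⟨hp1, hp2⟩ := hmemp
  have hdm (h0 : cminus ≠ 0) := dvd_of_Rent_ne_zero (s := -1) (by omega) hcok (Or.inr rfl)
    (by omega) h0 hm1 hm2
  have hdp (h0 : cplus ≠ 0) := dvd_of_Rent_ne_zero (s := 1) (by omega) hcok (Or.inl rfl)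
    (by omega) h0 hp1 hp2
  have hz : cminus = 0 ↔ 2*k = 4 := by
    constructor
    · rintro rfl
      have := Rent_zero_ne_zero_iff.1 hm2
      omega
    · intro h
      have h0 : 0 ∈ (Finset.range m).filter (fun l => Rent m (2*k) p A (k - 1) l ≠ 0) :=
        Finset.mem_filter.2 ⟨Finset.mem_range.2 hm, Rent_zero_ne_zero_iff.2 (by omega)⟩
      rw [hcm, Finset.mem_singleton] at h0
      exact h0.symm
  have hml : cminus = lstar → 2*k = 6 := by
    rintro rfl
    rcases dvd_sub_one_or_dvd_add_one (hdm (by omega)) hstar with h | h <;>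
      have := Int.eq_zero_of_abs_lt_dvd h (by rw [abs_lt]; omega) <;> omega
  have hlm : 2*k = 6 → cminus = lstar := by
    intro h
    have hk : k = 3 := by omega
    subst hk
    have hc0 : cminus ≠ 0 := fun h0 => by have := hz.1 h0; omega
    have hcancel {x : ℤ} (hx : ((2*m+1 : ℕ) : ℤ) ∣ 6 * x) : ((2*m+1 : ℕ) : ℤ) ∣ x :=
      hcoq.dvd_of_dvd_mul_left (by exact_mod_cast hx)
    have hadd : ¬ ((2*m+1 : ℕ) : ℤ) ∣ (cminus : ℤ) + lstar := fun hd => by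
      have := Int.le_of_dvd (by omega) hd
      omega
    have hsub (hd : ((2*m+1 : ℕ) : ℤ) ∣ (cminus : ℤ) - lstar) : cminus = lstar := by
      have := Int.eq_zero_of_abs_lt_dvd hd (by rw [abs_lt]; omega)
      omega
    rcases hdm hc0 with ⟨a, ha⟩ | ⟨a, ha⟩ <;> rcases hstar with ⟨b, hb⟩ | ⟨b, hb⟩ <;>
      push_cast at ha hb
    · exact absurd (hcancel ⟨a + b, by push_cast; linarith⟩) hadd
    · exact hsub (hcancel ⟨a - b, by push_cast; linarith⟩)
    · exact hsub (hcancel ⟨a - b, by push_cast; linarith⟩)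
    · exact absurd (hcancel ⟨a + b, by push_cast; linarith⟩) hadd
  refine ⟨hz, ⟨hml, hlm⟩, fun h8 => ⟨fun h => ?_, fun h => ?_, fun h => ?_, ?_⟩⟩
  · have := hz.1 h
    omega
  · have := hml h
    omega
  · subst h
    have := Rent_zero_ne_zero_iff.1 hp2
    omega
  · rintro rfl
    rcases dvd_sub_one_or_dvd_add_one (hdp (by omega)) hstar with h | h <;>
      have := Int.eq_zero_of_abs_lt_dvd h (by rw [abs_lt]; omega) <;> omega
end

section
/- Suppose q is odd with q ≥ 3, r = 2m+1 is coprime to q, and m > (q+5)/2. Then row m − (q+1)/2 and row m − (q−3)/2 of the matrix R each contain exactly one nonzero entry; the columns containing these two entries are distinct, and neither of these columns is column 0 or column l*. -/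
open scoped Classical

lemma rho_eq_iff {m n i : ℕ} (hi1 : 1 ≤ i) (him : i ≤ m) :
    rho (2*m+1) n = i ↔
      ((2*m+1 : ℕ) : ℤ) ∣ (n : ℤ) - i ∨ ((2*m+1 : ℕ) : ℤ) ∣ (n : ℤ) + i := by
  have hlt : n % (2*m+1) < 2*m+1 := Nat.mod_lt _ (by omega)
  have hdm := Nat.div_add_mod n (2*m+1)
  unfold rho
  set s := n % (2*m+1)
  set t := n / (2*m+1)
  have hd : ((2*m+1 : ℕ) : ℤ) ∣ (n : ℤ) - s :=
    ⟨t, by rw [← hdm]; push_cast; ring⟩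
  constructor
  · intro h
    rcases (by omega : s = i ∨ s + i = 2*m+1) with h | h
    · left; rwa [← h]
    · right
      have : (n : ℤ) + i = (n - s) + ((2*m+1 : ℕ) : ℤ) := by rw [← h]; push_cast; ring
      rw [this]
      exact dvd_add hd (dvd_refl _)
  · rintro (h | h)
    · have h1 : ((2*m+1 : ℕ) : ℤ) ∣ (s : ℤ) - i := by
        have := dvd_sub h hd
        ring_nf at this ⊢
        exact this
      have := Int.eq_zero_of_abs_lt_dvd h1 (by rw [abs_lt]; omega)
      omega
    · have h1 : ((2*m+1 : ℕ) : ℤ) ∣ (s : ℤ) + i - ((2*m+1 : ℕ) : ℤ) := by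
        refine dvd_sub ?_ (dvd_refl _)
        have := dvd_sub h hd
        ring_nf at this ⊢
        exact this
      have := Int.eq_zero_of_abs_lt_dvd h1 (by rw [abs_lt]; omega)
      omega

/-- `q * l` is congruent to `a` or to `-a` modulo `r`. -/
def MulCongrUpToSign (r q : ℕ) (a : ℤ) (l : ℕ) : Prop :=
  (r : ℤ) ∣ (q : ℤ) * l - a ∨ (r : ℤ) ∣ (q : ℤ) * l + a

namespace MulCongrUpToSign

lemma dvd_sub_or_add {r q l : ℕ} {a b : ℤ} (ha : MulCongrUpToSign r q a l)
    (hb : MulCongrUpToSign r q b l) : (r : ℤ) ∣ a - b ∨ (r : ℤ) ∣ a + b := by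
  rcases ha with ha | ha <;> rcases hb with hb | hb
  · left; convert Int.dvd_sub hb ha using 1; ring
  · right; convert Int.dvd_sub hb ha using 1; ring
  · right; convert Int.dvd_sub ha hb using 1; ring
  · left; convert Int.dvd_sub ha hb using 1; ring

lemma unique {m q l l' : ℕ} {a : ℤ} (hco : Nat.Coprime (2*m+1) q)
    (hl : l ≤ m) (hl' : l' ≤ m) (h : MulCongrUpToSign (2*m+1) q a l)
    (h' : MulCongrUpToSign (2*m+1) q a l') : l = l' := by
  have hco' : IsCoprime ((2*m+1 : ℕ) : ℤ) (q : ℤ) := Nat.isCoprime_iff_coprime.mpr hco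
  have key : ((2*m+1 : ℕ) : ℤ) ∣ (q : ℤ) * ((l : ℤ) - l') ∨
      ((2*m+1 : ℕ) : ℤ) ∣ (q : ℤ) * ((l : ℤ) + l') := by
    rcases h with h | h <;> rcases h' with h' | h'
    · left; convert Int.dvd_sub h h' using 1; ring
    · right; convert Int.dvd_add h h' using 1; ring
    · right; convert Int.dvd_add h h' using 1; ring
    · left; convert Int.dvd_sub h h' using 1; ring
  rcases key with h | h <;>
  · have := Int.eq_zero_of_abs_lt_dvd (hco'.dvd_of_dvd_mul_left h) (by rw [abs_lt]; omega)
    omega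

lemma exists_le {m q : ℕ} (hco : Nat.Coprime (2*m+1) q) (a : ℤ) :
    ∃ l ≤ m, MulCongrUpToSign (2*m+1) q a l := by
  obtain ⟨u, v, huv⟩ : IsCoprime ((2*m+1 : ℕ) : ℤ) (q : ℤ) :=
    Nat.isCoprime_iff_coprime.mpr hco
  have hs0 := Int.emod_nonneg (v * a) (b := ((2*m+1 : ℕ) : ℤ)) (by omega)
  have hs1 := Int.emod_lt_of_pos (v * a) (b := ((2*m+1 : ℕ) : ℤ)) (by omega)
  have hdm := Int.emod_add_mul_ediv (v * a) ((2*m+1 : ℕ) : ℤ)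
  set s := (v * a) % ((2*m+1 : ℕ) : ℤ)
  set t := (v * a) / ((2*m+1 : ℕ) : ℤ)
  have hqs : (q : ℤ) * s - a = ((2*m+1 : ℕ) : ℤ) * (- u * a - q * t) := by
    linear_combination (q : ℤ) * hdm + a * huv
  by_cases hsm : s ≤ m
  · refine ⟨s.toNat, by omega, Or.inl ?_⟩
    rw [Int.toNat_of_nonneg hs0]
    exact ⟨_, hqs⟩
  · refine ⟨(((2*m+1 : ℕ) : ℤ) - s).toNat, by omega, Or.inr ?_⟩
    rw [Int.toNat_of_nonneg (by omega)]
    exact ⟨q - (- u * a - q * t), by linear_combination -hqs⟩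

lemma pos {r q l : ℕ} {a : ℤ} (ha : ¬ (r : ℤ) ∣ a) (h : MulCongrUpToSign r q a l) :
    1 ≤ l := by
  rcases Nat.eq_zero_or_pos l with rfl | hl
  · exact absurd (by simpa [MulCongrUpToSign] using h) ha
  · exact hl

end MulCongrUpToSign

lemma Rent_ne_zero_iff {m q : ℕ} {p : ℤ} {A : ℂ} {i l : ℕ} (hA : A ≠ 0) (hq : 1 ≤ q)
    (hco : Nat.Coprime (2*m+1) q) (hi1 : 1 ≤ i) (him : i ≤ m) (hl1 : 1 ≤ l) (hlm : l ≤ m) :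
    Rent m q p A i l ≠ 0 ↔
      MulCongrUpToSign (2*m+1) q ((i : ℤ) - 1) l ∨
        MulCongrUpToSign (2*m+1) q ((i : ℤ) + 1) l := by
  have hql : 1 ≤ q * l := Nat.mul_pos hq hl1
  have hnz : ¬ (rho (2*m+1) (q*l+1) = i ∧ rho (2*m+1) (q*l-1) = i) := by
    rintro ⟨h1, h2⟩
    rw [rho_eq_iff hi1 him] at h1 h2
    push_cast [Nat.cast_sub hql] at h1 h2
    have hco' : IsCoprime ((2*m+1 : ℕ) : ℤ) (q : ℤ) := Nat.isCoprime_iff_coprime.mpr hco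
    have hr2 : IsCoprime ((2*m+1 : ℕ) : ℤ) 2 := ⟨1, -m, by push_cast; ring⟩
    have key : ((2*m+1 : ℕ) : ℤ) ∣ 2 * 1 ∨ ((2*m+1 : ℕ) : ℤ) ∣ 2 * ((q : ℤ) * l) := by
      push_cast
      rcases h1 with h1 | h1 <;> rcases h2 with h2 | h2
      · left; convert Int.dvd_sub h1 h2 using 1; ring
      · right; convert Int.dvd_add h1 h2 using 1; ring
      · right; convert Int.dvd_add h1 h2 using 1; ring
      · left; convert Int.dvd_sub h1 h2 using 1; ring
    rcases key with h | h
    · have := Int.eq_zero_of_abs_lt_dvd (hr2.dvd_of_dvd_mul_left h) (by rw [abs_lt]; omega)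
      omega
    · have := Int.eq_zero_of_abs_lt_dvd
        (hco'.dvd_of_dvd_mul_left (hr2.dvd_of_dvd_mul_left h)) (by rw [abs_lt]; omega)
      omega
  have hiff : MulCongrUpToSign (2*m+1) q ((i : ℤ) - 1) l ∨
      MulCongrUpToSign (2*m+1) q ((i : ℤ) + 1) l ↔
      rho (2*m+1) (q*l+1) = i ∨ rho (2*m+1) (q*l-1) = i := by
    rw [rho_eq_iff hi1 him, rho_eq_iff hi1 him]
    unfold MulCongrUpToSign
    push_cast [Nat.cast_sub hql]
    rw [show (q : ℤ) * l + 1 - i = q * l - (i - 1) by ring,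
      show (q : ℤ) * l + 1 + i = q * l + (i + 1) by ring,
      show (q : ℤ) * l - 1 - i = q * l - (i + 1) by ring,
      show (q : ℤ) * l - 1 + i = q * l + (i - 1) by ring]
    tauto
  have hAp : A ^ (2 * p * (l : ℤ)) ≠ 0 := zpow_ne_zero _ hA
  rw [hiff]
  unfold Rent sgn
  rw [if_neg (by omega)]
  by_cases h1 : rho (2*m+1) (q*l+1) = i <;> by_cases h2 : rho (2*m+1) (q*l-1) = i
  · exact absurd ⟨h1, h2⟩ hnz
  all_goals simp [h1, h2, hAp]

/-- If column `m`, which is not a column of `R`, accounts for one of the two residue classes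
`±(i - 1)`, `±(i + 1)`, then row `i` has a single nonzero entry, coming from the other class. -/
lemma exists_filter_Rent_eq_singleton {m q : ℕ} {p : ℤ} {A : ℂ} {i : ℕ} {a b : ℤ} (hA : A ≠ 0)
    (hq : 1 ≤ q) (hco : Nat.Coprime (2*m+1) q) (hi2 : 2 ≤ i) (him : i ≤ m)
    (hab : a = i - 1 ∧ b = i + 1 ∨ a = i + 1 ∧ b = i - 1)
    (ha : MulCongrUpToSign (2*m+1) q a m) (hb : ¬ ((2*m+1 : ℕ) : ℤ) ∣ b) :
    ∃ c, c ≠ 0 ∧ MulCongrUpToSign (2*m+1) q b c ∧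
      (Finset.range m).filter (fun l => Rent m q p A i l ≠ 0) = {c} := by
  obtain ⟨c, hcm, hc⟩ := MulCongrUpToSign.exists_le hco b
  have hc1 : 1 ≤ c := hc.pos hb
  have hcm' : c ≠ m := by
    rintro rfl
    rcases ha.dvd_sub_or_add hc with h | h <;>
    · have := Int.eq_zero_of_abs_lt_dvd h (by rw [abs_lt]; omega)
      omega
  have hrow : ∀ l, 1 ≤ l → l ≤ m → (Rent m q p A i l ≠ 0 ↔
      MulCongrUpToSign (2*m+1) q a l ∨ MulCongrUpToSign (2*m+1) q b l) := by
    intro l hl hlm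
    rw [Rent_ne_zero_iff hA hq hco (by omega) him hl hlm]
    rcases hab with ⟨rfl, rfl⟩ | ⟨rfl, rfl⟩
    · rfl
    · exact or_comm
  refine ⟨c, by omega, hc, ?_⟩
  ext l
  simp only [Finset.mem_filter, Finset.mem_range, Finset.mem_singleton]
  constructor
  · rintro ⟨hlm, hl⟩
    rcases Nat.eq_zero_or_pos l with rfl | hl0
    · exact absurd (by simp [Rent]; omega) hl
    rcases (hrow l hl0 hlm.le).mp hl with h | h
    · have := h.unique hco hlm.le le_rfl ha
      omega
    · exact h.unique hco hlm.le hcm hc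
  · rintro rfl
    exact ⟨by omega, (hrow l hc1 hcm).mpr (Or.inr hc)⟩

/-- For odd `q ≥ 3`, rows `m − (q+1)/2` and `m − (q−3)/2` of `R` each contain exactly one
nonzero entry; the columns containing these two entries are distinct, and neither of
these columns is column `0` or column `l*`. -/
theorem stmt_7 (m q : ℕ) (hm : 0 < m) (hqo : Odd q) (hq3 : 3 ≤ q)
    (hco : Nat.Coprime (2*m+1) q) (hmq : q + 5 < 2*m) (p : ℤ) (A : ℂ)
    (hA : IsPrimitiveRoot A (2*(2*m+1)))
    (lstar : ℕ) (hl1 : 1 ≤ lstar) (hl2 : lstar ≤ m)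
    (hldvd : (2*m+1) ∣ (q*lstar+1) ∨ (2*m+1) ∣ (q*lstar-1)) :
    ∃ cminus cplus : ℕ, cminus ≠ cplus ∧
      cminus ≠ 0 ∧ cplus ≠ 0 ∧ cminus ≠ lstar ∧ cplus ≠ lstar ∧
      (Finset.range m).filter (fun l => Rent m q p A (m - (q+1)/2) l ≠ 0) = {cminus} ∧
      (Finset.range m).filter (fun l => Rent m q p A (m - (q-3)/2) l ≠ 0) = {cplus} := by
  obtain ⟨k, rfl⟩ := hqo
  have hA0 : A ≠ 0 := hA.ne_zero (by omega)
  have hm_class : MulCongrUpToSign (2*m+1) (2*k+1) ((m : ℤ) - k) m :=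
    Or.inl ⟨k, by push_cast; ring⟩
  have not_dvd : ∀ x : ℤ, x ≠ 0 → -(2*m+1 : ℤ) < x → x < 2*m+1 →
      ¬ ((2*m+1 : ℕ) : ℤ) ∣ x := fun x hx h1 h2 h =>
    hx (Int.eq_zero_of_abs_lt_dvd h (by rw [abs_lt]; push_cast; exact ⟨h1, h2⟩))
  obtain ⟨c, hc0, hc, hcf⟩ := exists_filter_Rent_eq_singleton (p := p)
    (i := m - (2*k+1+1)/2) (a := (m : ℤ) - k) (b := (m : ℤ) - k - 2) hA0 (by omega) hco
    (by omega) (by omega) (by omega) hm_class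
    (not_dvd _ (by omega) (by omega) (by omega))
  obtain ⟨d, hd0, hd, hdf⟩ := exists_filter_Rent_eq_singleton (p := p)
    (i := m - (2*k+1-3)/2) (a := (m : ℤ) - k) (b := (m : ℤ) - k + 2) hA0 (by omega) hco
    (by omega) (by omega) (by omega) hm_class
    (not_dvd _ (by omega) (by omega) (by omega))
  have hstar : MulCongrUpToSign (2*m+1) (2*k+1) 1 lstar := by
    have hpos : 1 ≤ (2*k+1) * lstar := Nat.mul_pos (by omega) hl1
    rcases hldvd with h | h <;> rw [← Int.natCast_dvd_natCast] at h
    · exact Or.inr (by simpa using h)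
    · exact Or.inl (by simpa [Nat.cast_sub hpos] using h)
  refine ⟨c, d, ?_, hc0, hd0, ?_, ?_, hcf, hdf⟩
  · rintro rfl
    rcases hc.dvd_sub_or_add hd with h | h <;>
      exact not_dvd _ (by omega) (by omega) (by omega) h
  · rintro rfl
    rcases hc.dvd_sub_or_add hstar with h | h <;>
      exact not_dvd _ (by omega) (by omega) (by omega) h
  · rintro rfl
    rcases hd.dvd_sub_or_add hstar with h | h <;>
      exact not_dvd _ (by omega) (by omega) (by omega) h
end
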